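/- arXiv:2410.01405 — 2 statements merged into one kernel-verified Lean document; each statement's English description precedes it below -/
import Mathlib

section
/- Let N, K ∈ ℕ with K ≥ N ≥ 1, and let u = (K^{N−1}, K^{N−2}, …, K, 1)ᵀ ∈ ℝ^N. Then there exist a Transformer block TF: ℝ^{8×N} → ℝ^{8×N} with hardmax attention having two heads, head size 1, and feed-forward width 5, and two token-wise affine maps L₁: ℝ² → ℝ^8 and L₂: ℝ^8 → ℝ, such that for every strictly decreasing tuple z ∈ {0,1,…,K−1}^N (z₁ > z₂ > ⋯ > z_N) and every vector w ∈ ℝ^N with nonnegative integer entries, applying L₂ ∘ TF^{∘N} ∘ L₁ column-wise to the 2×N matrix whose first row is zᵀ and second row is wᵀ yields the constant row vector (2·uᵀz − w_N)·1_Nᵀ. -/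
open scoped BigOperators
open MeasureTheory Matrix

noncomputable section

/-- ReLU activation. -/
def relu (x : ℝ) : ℝ := max x 0

/-- Parameters of a feed-forward layer `FF(x) = W₂·ReLU(W₁x + b₁) + b₂`
of width `q` on `ℝ^m`. -/
structure FFParams (m q : ℕ) where
  W1 : Matrix (Fin q) (Fin m) ℝ
  W2 : Matrix (Fin m) (Fin q) ℝ
  b1 : Fin q → ℝ
  b2 : Fin m → ℝ

/-- Application of a feed-forward layer. -/
def FFParams.apply {m q : ℕ} (P : FFParams m q) (x : Fin m → ℝ) : Fin m → ℝ :=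
  P.W2.mulVec (fun j => relu (P.W1.mulVec x j + P.b1 j)) + P.b2

/-- Parameters of a self-attention layer with `h` heads and head size `s`
on `ℝ^{m×N}`. -/
structure AttnParams (m s h : ℕ) where
  WO : Fin h → Matrix (Fin m) (Fin s) ℝ
  WV : Fin h → Matrix (Fin s) (Fin m) ℝ
  WK : Fin h → Matrix (Fin s) (Fin m) ℝ
  WQ : Fin h → Matrix (Fin s) (Fin m) ℝ

/-- Apply a column map `σ` (e.g. softmax or hardmax) to each column of a
square matrix. -/
def colwise {N : ℕ} (σ : (Fin N → ℝ) → (Fin N → ℝ))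
    (A : Matrix (Fin N) (Fin N) ℝ) : Matrix (Fin N) (Fin N) ℝ :=
  Matrix.of fun i j => σ (fun k => A k j) i

/-- Self-attention: `Attn(X) = Σᵢ W_O^i W_V^i X σ[(W_K^i X)ᵀ W_Q^i X]`,
with `σ` applied columnwise. -/
def AttnParams.apply {m s h N : ℕ} (P : AttnParams m s h)
    (σ : (Fin N → ℝ) → (Fin N → ℝ)) (X : Matrix (Fin m) (Fin N) ℝ) :
    Matrix (Fin m) (Fin N) ℝ :=
  ∑ i : Fin h, P.WO i * (P.WV i * X) * colwise σ ((P.WK i * X)ᵀ * (P.WQ i * X))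

/-- Parameters of a Transformer block. -/
structure TFParams (m s h q : ℕ) where
  attn : AttnParams m s h
  ff : FFParams m q

/-- Transformer block: `TF(X) = X' + FF(X')` (tokenwise), `X' = X + Attn(X)`. -/
def TFParams.apply {m s h q N : ℕ} (P : TFParams m s h q)
    (σ : (Fin N → ℝ) → (Fin N → ℝ)) (X : Matrix (Fin m) (Fin N) ℝ) :
    Matrix (Fin m) (Fin N) ℝ :=
  let X' := X + P.attn.apply σ X
  X' + Matrix.of fun i j => P.ff.apply (fun k => X' k j) i

/-- Softmax applied to a column. -/
def softmaxCol {N : ℕ} (v : Fin N → ℝ) : Fin N → ℝ :=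
  fun i => Real.exp (v i) / ∑ j, Real.exp (v j)

open Classical in
/-- Hardmax applied to a column: the one-hot indicator of the (least) index
achieving the maximal entry. -/
def hardmaxCol {N : ℕ} (v : Fin N → ℝ) : Fin N → ℝ :=
  fun i => if (∀ j, v j ≤ v i) ∧ (∀ j, v j = v i → i ≤ j) then 1 else 0

/-- Token-wise (column-wise) application of the affine map `x ↦ Ax + b`. -/
def affineCols {m d N : ℕ} (A : Matrix (Fin m) (Fin d) ℝ) (b : Fin m → ℝ)
    (X : Matrix (Fin d) (Fin N) ℝ) : Matrix (Fin m) (Fin N) ℝ :=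
  Matrix.of fun i j => A.mulVec (fun k => X k j) i + b i

/-- The input cube `[0,1]^{d×N}`. -/
def cube (d N : ℕ) : Set (Matrix (Fin d) (Fin N) ℝ) :=
  {X | ∀ i j, X i j ∈ Set.Icc (0 : ℝ) 1}

/-- Entrywise `p`-norm of a matrix. -/
def pNorm {d N : ℕ} (p : ℝ) (X : Matrix (Fin d) (Fin N) ℝ) : ℝ :=
  (∑ i, ∑ j, |X i j| ^ p) ^ (1 / p)

/-- Entrywise `p`-norm of a vector. -/
def vpNorm {d : ℕ} (p : ℝ) (x : Fin d → ℝ) : ℝ :=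
  (∑ i, |x i| ^ p) ^ (1 / p)

/-- Entrywise `2`-norm of a matrix. -/
def twoNorm {d N : ℕ} (X : Matrix (Fin d) (Fin N) ℝ) : ℝ :=
  Real.sqrt (∑ i, ∑ j, X i j ^ 2)

/-- Entrywise `2`-norm of a vector. -/
def vtwoNorm {d : ℕ} (x : Fin d → ℝ) : ℝ :=
  Real.sqrt (∑ i, x i ^ 2)

/-- Modulus of sequence continuity
`ω_f(δ) = sup{‖f(X)−f(X')‖_p : X, X' ∈ [0,1]^{d×N}, ‖X−X'‖₂ ≤ δ}`. -/
def modSeq {d N : ℕ} (p : ℝ)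
    (f : Matrix (Fin d) (Fin N) ℝ → Matrix (Fin d) (Fin N) ℝ) (δ : ℝ) : ℝ :=
  sSup {t | ∃ X ∈ cube d N, ∃ X' ∈ cube d N,
    twoNorm (X - X') ≤ δ ∧ t = pNorm p (f X - f X')}

/-- Modulus of contextual continuity `ω^cont_f`. -/
def modCtx {d N : ℕ} (p : ℝ)
    (f : Matrix (Fin d) (Fin N) ℝ → Matrix (Fin d) (Fin N) ℝ) (δ : ℝ) : ℝ :=
  sSup {t | ∃ n : Fin N, ∃ X ∈ cube d N, ∃ X' ∈ cube d N,
    twoNorm (X - X') ≤ δ ∧ (∀ i, X i n = X' i n) ∧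
    t = vpNorm p (fun i => f X i n - f X' i n)}

/-- Modulus of token continuity `ω^tok_f`. -/
def modTok {d N : ℕ} (p : ℝ)
    (f : Matrix (Fin d) (Fin N) ℝ → Matrix (Fin d) (Fin N) ℝ) (δ : ℝ) : ℝ :=
  sSup {t | ∃ n : Fin N, ∃ X ∈ cube d N, ∃ X' ∈ cube d N,
    vtwoNorm (fun i => X i n - X' i n) ≤ δ ∧
    (∀ q, q ≠ n → ∀ i, X i q = X' i q) ∧
    t = vpNorm p (fun i => f X i n - f X' i n)}

instance matrixMeasureSpace (d N : ℕ) :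
    MeasureSpace (Matrix (Fin d) (Fin N) ℝ) :=
  inferInstanceAs (MeasureSpace (Fin d → Fin N → ℝ))

/-- `L^p` norm of `g` over the cube `[0,1]^{d×N}`:
`(∫_{[0,1]^{d×N}} ‖g(X)‖_p^p dX)^{1/p}`. -/
def LpNormOn {d N : ℕ} (p : ℝ)
    (g : Matrix (Fin d) (Fin N) ℝ → Matrix (Fin d) (Fin N) ℝ) : ℝ :=
  (∫ X in cube d N, pNorm p (g X) ^ p) ^ (1 / p)

/-- Permutation equivariance on the cube: `f(XP) = f(X)P` for every
permutation matrix `P`, expressed via column permutations. -/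
def PermEquivariant {d N : ℕ}
    (f : Matrix (Fin d) (Fin N) ℝ → Matrix (Fin d) (Fin N) ℝ) : Prop :=
  ∀ σ : Equiv.Perm (Fin N), ∀ X ∈ cube d N,
    f (X.submatrix id σ) = (f X).submatrix id σ

/-- The looped network `L₂ ∘ TF^{∘r} ∘ L₁` with token-wise affine maps. -/
def loopedNet {d m N s h q : ℕ} (σ : (Fin N → ℝ) → (Fin N → ℝ))
    (P : TFParams m s h q)
    (A1 : Matrix (Fin m) (Fin d) ℝ) (b1 : Fin m → ℝ)
    (A2 : Matrix (Fin d) (Fin m) ℝ) (b2 : Fin d → ℝ) (r : ℕ)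
    (X : Matrix (Fin d) (Fin N) ℝ) : Matrix (Fin d) (Fin N) ℝ :=
  affineCols A2 b2 ((P.apply σ)^[r] (affineCols A1 b1 X))

end

theorem hardmaxCol_eq_single {N : ℕ} {v : Fin N → ℝ} {k : Fin N}
    (hk : ∀ j, j ≠ k → v j < v k) : hardmaxCol v = Pi.single k 1 := by
  funext i
  by_cases hi : i = k
  · subst hi
    have hmax : (∀ j, v j ≤ v i) ∧ ∀ j, v j = v i → i ≤ j := by
      refine ⟨fun j => ?_, fun j hj => ?_⟩
      · by_cases h : j = i
        · rw [h]
        · exact (hk j h).le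
      · by_cases h : j = i
        · exact h.ge
        · exact absurd hj (hk j h).ne
    rw [Pi.single_eq_same, hardmaxCol, if_pos hmax]
  · have hmax : ¬ ((∀ j, v j ≤ v i) ∧ ∀ j, v j = v i → i ≤ j) :=
      fun h => absurd (h.1 k) (not_le.mpr (hk i hi))
    rw [Pi.single_eq_of_ne hi, hardmaxCol, if_neg hmax]

/-- If in every head each query has its strictly largest score at the key `k`, hardmax attention
returns the value of token `k` in every column. -/
theorem AttnParams.apply_hardmaxCol_of_strict_max {m s h N : ℕ} (P : AttnParams m s h)
    (X : Matrix (Fin m) (Fin N) ℝ) (k : Fin N)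
    (hk : ∀ a l j, l ≠ k →
      ((P.WK a * X)ᵀ * (P.WQ a * X)) l j < ((P.WK a * X)ᵀ * (P.WQ a * X)) k j)
    (i : Fin m) (j : Fin N) :
    P.apply hardmaxCol X i j = ∑ a, (P.WO a * (P.WV a * X)) i k := by
  rw [AttnParams.apply, Matrix.sum_apply]
  refine Finset.sum_congr rfl fun a _ => ?_
  have hcol : ∀ l, colwise hardmaxCol ((P.WK a * X)ᵀ * (P.WQ a * X)) l j
      = (Pi.single k 1 : Fin N → ℝ) l := fun l => by
    rw [colwise, Matrix.of_apply, hardmaxCol_eq_single (fun l hl => hk a l j hl)]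
  rw [Matrix.mul_apply]
  simp only [hcol]
  simp [Pi.single_apply]

/-- A block that reads off the token with the largest key: in every token it stores that key in
row `2` and the payload of that token in row `5`, updates the base-`K` accumulator in row `3`, and
lowers the key (row `0`) of the selected token below all the others. -/
noncomputable def selectMaxBlock (K : ℝ) : TFParams 8 1 2 5 where
  attn :=
    { WO := ![!![0; 0; 1; 0; 0; 0; 0; 0], !![0; 0; 0; 0; 0; 1; 0; 0]]
      WV := ![!![1, 0, -1, 0, 0, 0, 0, 0], !![0, 0, 0, 0, 1, -1, 0, 0]]
      WK := fun _ => !![1, 0, 0, 0, 0, 0, 0, 0]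
      WQ := fun _ => !![0, 1, 0, 0, 0, 0, 0, 0] }
  ff :=
    { W1 := !![1, 0, -1, 0, 0, 0, 0, 0;
               0, 0, 0, 1, 0, 0, 0, 0;
               0, 0, 1, 0, 0, 0, 0, 0;
               0, 0, 0, 0, 0, 0, 0, 0;
               0, 0, 0, 0, 0, 0, 0, 0]
      W2 := !![-2 * K, 0, 0, 0, 0;
               0, 0, 0, 0, 0;
               0, 0, 0, 0, 0;
               0, K - 1, 1, 0, 0;
               0, 0, 0, 0, 0;
               0, 0, 0, 0, 0;
               0, 0, 0, 0, 0;
               0, 0, 0, 0, 0]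
      b1 := ![1, 0, 0, 0, 0]
      b2 := 0 }

/-- Token states with keys `y`, payloads `w`, last selected key `t`, accumulator `s`, and last
selected payload `r`. -/
def selectState {N : ℕ} (y w : Fin N → ℝ) (t s r : ℝ) : Matrix (Fin 8) (Fin N) ℝ :=
  Matrix.of fun i j => ![y j, 1, t, s, w j, r, 0, 0] i

theorem selectMaxBlock_apply_selectState {N : ℕ} (K : ℝ) (y w : Fin N → ℝ) (t s r : ℝ) (k : Fin N)
    (hk : ∀ j, j ≠ k → y j < y k) :
    (selectMaxBlock K).apply hardmaxCol (selectState y w t s r) =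
      selectState (fun j => y j - 2 * K * relu (y j - y k + 1)) w (y k)
        (s + (K - 1) * relu s + relu (y k)) (w k) := by
  set X := selectState y w t s r with hX
  have hattn : ∀ i j, (selectMaxBlock K).attn.apply hardmaxCol X i j
      = ![0, 0, y k - t, 0, 0, w k - r, 0, 0] i := by
    intro i j
    rw [AttnParams.apply_hardmaxCol_of_strict_max _ _ k]
    · fin_cases i <;>
        simp [selectMaxBlock, hX, selectState, Matrix.mul_apply, Fin.sum_univ_succ] <;> ring
    · intro a l j hl
      simp only [selectMaxBlock, hX, selectState, Matrix.mul_apply, Matrix.transpose_apply]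
      simpa [Fin.sum_univ_succ] using hk l hl
  have hX' : X + (selectMaxBlock K).attn.apply hardmaxCol X = selectState y w (y k) s (w k) := by
    ext i j
    rw [Matrix.add_apply, hattn]
    fin_cases i <;> simp [hX, selectState]
  rw [TFParams.apply, hX']
  ext i j
  fin_cases i <;>
    simp [selectState, selectMaxBlock, FFParams.apply, Matrix.mulVec, dotProduct,
      Fin.sum_univ_succ] <;> ring_nf

/-- Keys after the first `k` tokens have been selected. -/
def remainingKeys {N : ℕ} (K : ℕ) (z : Fin N → ℕ) (k : ℕ) (j : Fin N) : ℝ :=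
  if (j : ℕ) < k then (z j : ℝ) - 2 * K else z j

theorem remainingKeys_lt {N K : ℕ} {z : Fin N → ℕ} (hz : ∀ n, z n < K)
    (hanti : ∀ m n : Fin N, m < n → z n < z m) (k j : Fin N) (hj : j ≠ k) :
    remainingKeys K z k j < remainingKeys K z k k := by
  have hjK : (z j : ℝ) < K := by exact_mod_cast hz j
  have hk0 : (0 : ℝ) ≤ z k := by positivity
  rcases lt_or_gt_of_ne hj with h | h
  · have : (j : ℕ) < k := h
    simp only [remainingKeys, this, if_true, lt_irrefl, if_false]
    linarith
  · have hnot : ¬ (j : ℕ) < k := not_lt.mpr (Fin.le_def.mp h.le)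
    simp only [remainingKeys, hnot, lt_irrefl, if_false]
    exact_mod_cast hanti k j h

theorem remainingKeys_succ {N K : ℕ} {z : Fin N → ℕ} (hz : ∀ n, z n < K)
    (hanti : ∀ m n : Fin N, m < n → z n < z m) (k j : Fin N) :
    remainingKeys K z k j - 2 * K * relu (remainingKeys K z k j - z k + 1)
      = remainingKeys K z (k + 1 : ℕ) j := by
  have hjK : (z j : ℝ) < K := by exact_mod_cast hz j
  have hK : (1 : ℝ) ≤ K := by exact_mod_cast (Nat.zero_le _).trans_lt (hz k)
  have hk0 : (0 : ℝ) ≤ z k := by positivity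
  rcases lt_trichotomy (j : ℕ) k with h | h | h
  · simp only [remainingKeys, h, h.trans (Nat.lt_succ_self _), if_true]
    rw [relu, max_eq_right (by linarith)]
    ring
  · obtain rfl : j = k := Fin.ext h
    simp [remainingKeys, relu]
  · have hle : (z j : ℝ) + 1 ≤ z k := by exact_mod_cast hanti k j h
    have h1 : ¬ (j : ℕ) < k := by omega
    have h2 : ¬ (j : ℕ) < (k : ℕ) + 1 := by omega
    simp only [remainingKeys, h1, h2, if_false]
    rw [relu, max_eq_right (by linarith)]
    ring

theorem sum_range_succ_mul_pow_sub {R : Type*} [CommSemiring R] (f : ℕ → R) (x : R) (k : ℕ) :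
    ∑ n ∈ Finset.range (k + 1), f n * x ^ (k - n)
      = x * ∑ n ∈ Finset.range k, f n * x ^ (k - 1 - n) + f k := by
  rw [Finset.sum_range_succ, Finset.mul_sum, Nat.sub_self, pow_zero, mul_one]
  congr 1
  refine Finset.sum_congr rfl fun n hn => ?_
  have hlt := Finset.mem_range.mp hn
  rw [show k - n = (k - 1 - n) + 1 by omega, pow_succ]
  ring

theorem iterate_selectMaxBlock {N K : ℕ} {z : Fin N → ℕ} (hz : ∀ n, z n < K)
    (hanti : ∀ m n : Fin N, m < n → z n < z m) (w : Fin N → ℝ) (f : ℕ → ℝ)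
    (hf : ∀ n : Fin N, f n = z n) (k : ℕ) (hk : k < N) :
    ((selectMaxBlock K).apply hardmaxCol)^[k + 1]
        (selectState (fun j => (z j : ℝ)) w 0 0 0) =
      selectState (remainingKeys K z (k + 1)) w (z ⟨k, hk⟩)
        (∑ n ∈ Finset.range (k + 1), f n * (K : ℝ) ^ (k - n)) (w ⟨k, hk⟩) := by
  have hstep : ∀ (k : ℕ) (hk : k < N) (t s r : ℝ), 0 ≤ s →
      (selectMaxBlock K).apply hardmaxCol (selectState (remainingKeys K z k) w t s r) =
        selectState (remainingKeys K z (k + 1)) w (z ⟨k, hk⟩) (K * s + f k) (w ⟨k, hk⟩) := by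
    intro k hk t s r hs
    have hself : remainingKeys K z k ⟨k, hk⟩ = z ⟨k, hk⟩ := by simp [remainingKeys]
    rw [selectMaxBlock_apply_selectState _ _ _ _ _ _ ⟨k, hk⟩
      (fun j hj => remainingKeys_lt hz hanti ⟨k, hk⟩ j hj), hself]
    congr 1
    · funext j
      exact remainingKeys_succ hz hanti ⟨k, hk⟩ j
    · rw [relu, relu, max_eq_left hs, max_eq_left (by positivity), hf ⟨k, hk⟩]
      ring
  have hnonneg : ∀ k < N, 0 ≤ ∑ n ∈ Finset.range (k + 1), f n * (K : ℝ) ^ (k - n) := by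
    intro k hk
    refine Finset.sum_nonneg fun n hn => ?_
    have hn' : n < N := (Nat.lt_succ_iff.mp (Finset.mem_range.mp hn)).trans_lt hk
    rw [hf ⟨n, hn'⟩]
    positivity
  induction k with
  | zero =>
    have h0 : (fun j => (z j : ℝ)) = remainingKeys K z 0 := by
      funext j
      simp [remainingKeys]
    rw [h0, Function.iterate_one, hstep 0 hk 0 0 0 le_rfl]
    simp
  | succ k ih =>
    rw [Function.iterate_succ_apply', ih (by omega),
      hstep (k + 1) hk _ _ _ (hnonneg k (by omega)), sum_range_succ_mul_pow_sub f (K : ℝ) (k + 1)]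
    rfl

/-- extended contextual mapping: for `K ≥ N ≥ 1` there is a
hardmax Transformer block `TF : ℝ^{8×N} → ℝ^{8×N}` with two heads, head size 1,
width 5, and token-wise affine maps `L₁ : ℝ² → ℝ^8`, `L₂ : ℝ^8 → ℝ` such that
for every strictly decreasing `z ∈ {0,…,K−1}^N` and every `w ∈ ℕ^N`, applying
`L₂ ∘ TF^{∘N} ∘ L₁` column-wise to the 2×N matrix with rows `zᵀ`, `wᵀ` yields
the constant row `(2·Σₙ zₙ·K^{N−n} − w_N)·1ᵀ`. -/
theorem extended_contextual_mapping (N K : ℕ) (hN : 1 ≤ N) (hK : N ≤ K) :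
    ∃ (P : TFParams 8 1 2 5) (A1 : Matrix (Fin 8) (Fin 2) ℝ) (b1 : Fin 8 → ℝ)
      (a2 : Fin 8 → ℝ) (c2 : ℝ),
      ∀ z : Fin N → ℕ, (∀ n, z n < K) →
        (∀ m n : Fin N, m < n → z n < z m) →
        ∀ w : Fin N → ℕ,
        ∀ j : Fin N,
          (∑ i, a2 i *
            ((P.apply hardmaxCol)^[N]
              (Matrix.of fun i j =>
                A1.mulVec (fun l : Fin 2 =>
                  if l = 0 then (z j : ℝ) else (w j : ℝ)) i + b1 i)) i j) + c2
            = 2 * (∑ n : Fin N, (z n : ℝ) * (K : ℝ) ^ (N - 1 - (n : ℕ)))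
              - (w ⟨N - 1, by omega⟩ : ℝ) := by
  refine ⟨selectMaxBlock K, !![1, 0; 0, 0; 0, 0; 0, 0; 0, 1; 0, 0; 0, 0; 0, 0],
    ![0, 1, 0, 0, 0, 0, 0, 0], ![0, 0, 0, 2, 0, -1, 0, 0], 0, ?_⟩
  intro z hz hanti w j
  obtain ⟨M, rfl⟩ : ∃ M, N = M + 1 := ⟨N - 1, by omega⟩
  let f : ℕ → ℝ := fun n => if h : n < M + 1 then (z ⟨n, h⟩ : ℝ) else 0
  have hf : ∀ n : Fin (M + 1), f n = z n := fun n => dif_pos n.isLt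
  have hstart : (Matrix.of fun i j =>
      (!![1, 0; 0, 0; 0, 0; 0, 0; 0, 1; 0, 0; 0, 0; 0, 0] : Matrix (Fin 8) (Fin 2) ℝ).mulVec
        (fun l : Fin 2 => if l = 0 then (z j : ℝ) else (w j : ℝ)) i
        + (![0, 1, 0, 0, 0, 0, 0, 0] : Fin 8 → ℝ) i)
      = selectState (fun j => (z j : ℝ)) (fun j => (w j : ℝ)) 0 0 0 := by
    ext i j
    fin_cases i <;> simp [selectState, Matrix.mulVec, dotProduct]
  rw [hstart, iterate_selectMaxBlock hz hanti _ f hf M (Nat.lt_succ_self M),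
    ← Fin.sum_univ_eq_sum_range (fun n => f n * (K : ℝ) ^ (M - n))]
  simp [selectState, Fin.sum_univ_eight, hf]
  ring
end

section
/- Let r ∈ ℕ, r ≥ 1, and let θ₁, θ₂, …, θ_r ∈ {0,1}. Then there exist a feed-forward layer FF: ℝ^6 → ℝ^6 of width 9 and two affine maps L₁: ℝ → ℝ^6, L₂: ℝ^6 → ℝ such that for every k ∈ {1,2,…,r}, L₂ ∘ (id + FF)^{∘r} ∘ L₁(k) = Σ_{l=1}^{k} θ_l. -/
/-- Every sequence of bits vanishing from `r` on is the digit sequence of the orbit of a point of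
`[0, 1/2]` under the shift of ternary expansions with digits `0` and `1`. -/
lemma exists_ternary_orbit (r : ℕ) (d : ℕ → ℝ) (hd : ∀ t, d t = 0 ∨ d t = 1)
    (hr : ∀ t, r ≤ t → d t = 0) :
    ∃ U : ℕ → ℝ, ∀ t, 0 ≤ U t ∧ U t ≤ 1 / 2 ∧ U (t + 1) = 3 * U t - d t := by
  induction r generalizing d with
  | zero => exact ⟨fun _ => 0, fun t => by simp [hr t (Nat.zero_le t)]⟩
  | succ n ih =>
    obtain ⟨V, hV⟩ := ih (fun t => d (t + 1)) (fun t => hd (t + 1))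
      (fun t ht => hr (t + 1) (by omega))
    refine ⟨fun t => Nat.casesOn t ((d 0 + V 0) / 3) V, fun t => ?_⟩
    cases t with
    | zero =>
      obtain ⟨h0, h1, -⟩ := hV 0
      change 0 ≤ (d 0 + V 0) / 3 ∧ (d 0 + V 0) / 3 ≤ 1 / 2 ∧ V 0 = 3 * ((d 0 + V 0) / 3) - d 0
      refine ⟨?_, ?_, by ring⟩ <;> rcases hd 0 with h | h <;> linarith
    | succ t => exact hV t

/-- The layer sending `(u, b, y, s, 0, 0)` to the increment that shifts the leading ternary digit of
`u` into `b`, decrements the counter `y` and adds `relu (y + b) - relu y` to `s`. -/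
noncomputable def bitLayer : FFParams 6 9 where
  W1 := !![6, 0, 0, 0, 0, 0;
           6, 0, 0, 0, 0, 0;
           1, 0, 0, 0, 0, 0;
           0, 1, 0, 0, 0, 0;
           0, 1, 1, 0, 0, 0;
           0, 0, 1, 0, 0, 0;
           0, 0, 0, 0, 0, 0;
           0, 0, 0, 0, 0, 0;
           0, 0, 0, 0, 0, 0]
  W2 := !![-1, 1, 2, 0, 0, 0, 0, 0, 0;
           1, -1, 0, -1, 0, 0, 0, 0, 0;
           0, 0, 0, 0, 0, 0, 0, 0, 0;
           0, 0, 0, 0, 1, -1, 0, 0, 0;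
           0, 0, 0, 0, 0, 0, 0, 0, 0;
           0, 0, 0, 0, 0, 0, 0, 0, 0]
  b1 := ![-1, -2, 0, 0, 0, 0, 0, 0, 0]
  b2 := ![0, 0, -1, 0, 0, 0]

lemma add_bitLayer_apply (u b y s : ℝ) :
    ![u, b, y, s, 0, 0] + bitLayer.apply ![u, b, y, s, 0, 0] =
      ![u + (2 * relu u - (relu (6 * u - 1) - relu (6 * u - 2))),
        b + (relu (6 * u - 1) - relu (6 * u - 2) - relu b),
        y - 1, s + (relu (b + y) - relu y), 0, 0] := by
  ext i
  fin_cases i <;>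
    simp [bitLayer, FFParams.apply, Matrix.mulVec, dotProduct, Fin.sum_univ_succ] <;> ring_nf

lemma relu_of_nonneg {x : ℝ} (hx : 0 ≤ x) : relu x = x := max_eq_left hx

lemma relu_of_nonpos {x : ℝ} (hx : x ≤ 0) : relu x = 0 := max_eq_right hx

lemma relu_sub_relu_eq_digit {u d : ℝ} (hd : d = 0 ∨ d = 1) (h0 : 0 ≤ 3 * u - d)
    (h1 : 3 * u - d ≤ 1 / 2) : relu (6 * u - 1) - relu (6 * u - 2) = d := by
  rcases hd with rfl | rfl
  · rw [relu_of_nonpos (by linarith), relu_of_nonpos (by linarith), sub_zero]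
  · rw [relu_of_nonneg (by linarith), relu_of_nonneg (by linarith)]
    ring

lemma relu_add_sub_relu_eq_ite {b : ℝ} (hb : b = 0 ∨ b = 1) (k t : ℕ) :
    relu (b + ((k : ℝ) - 1 - t)) - relu ((k : ℝ) - 1 - t) = if t < k then b else 0 := by
  have hb0 : 0 ≤ b := by rcases hb with rfl | rfl <;> norm_num
  have hb1 : b ≤ 1 := by rcases hb with rfl | rfl <;> norm_num
  split_ifs with h
  · have h' : (t : ℝ) + 1 ≤ k := by exact_mod_cast h
    rw [relu_of_nonneg (by linarith), relu_of_nonneg (by linarith)]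
    ring
  · have h' : (k : ℝ) ≤ t := by exact_mod_cast not_lt.mp h
    rw [relu_of_nonpos (by linarith), relu_of_nonpos (by linarith), sub_zero]

lemma iterate_bitLayer {d U : ℕ → ℝ} (hd : ∀ t, d t = 0 ∨ d t = 1)
    (hU : ∀ t, 0 ≤ U t ∧ U t ≤ 1 / 2 ∧ U (t + 1) = 3 * U t - d t) (k n : ℕ) :
    (fun x => x + bitLayer.apply x)^[n] ![U 1, d 0, (k : ℝ) - 1, 0, 0, 0] =
      ![U (n + 1), d n, (k : ℝ) - 1 - n,
        ∑ t ∈ Finset.range n, if t < k then d t else 0, 0, 0] := by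
  induction n with
  | zero => simp
  | succ n ih =>
    obtain ⟨h0, -, h⟩ := hU (n + 1)
    have hdigit := relu_sub_relu_eq_digit (hd (n + 1)) (h ▸ (hU (n + 2)).1) (h ▸ (hU (n + 2)).2.1)
    have hdn : 0 ≤ d n := by rcases hd n with h | h <;> norm_num [h]
    rw [Function.iterate_succ_apply', ih, add_bitLayer_apply, hdigit, relu_of_nonneg h0,
      relu_of_nonneg hdn, relu_add_sub_relu_eq_ite (hd n), h, Finset.sum_range_succ]
    push_cast
    ring_nf

/-- bit extraction: given bits `θ₁,…,θ_r ∈ {0,1}` there exist a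
feed-forward layer `FF : ℝ^6 → ℝ^6` of width 9 and affine maps `L₁ : ℝ → ℝ^6`,
`L₂ : ℝ^6 → ℝ` such that `L₂((id+FF)^{∘r}(L₁ k)) = Σ_{l=1}^k θ_l` for every
`k ∈ {1,…,r}`. -/
theorem bit_extraction (r : ℕ) (hr : 1 ≤ r) (θ : Fin r → ℝ)
    (hθ : ∀ l, θ l = 0 ∨ θ l = 1) :
    ∃ (P : FFParams 6 9) (a1 b1 : Fin 6 → ℝ) (a2 : Fin 6 → ℝ) (c2 : ℝ),
      ∀ k : ℕ, 1 ≤ k → k ≤ r →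
        (∑ i, a2 i * ((fun x => x + P.apply x)^[r]
            (fun j => a1 j * (k : ℝ) + b1 j)) i) + c2
          = ∑ l ∈ Finset.univ.filter (fun l : Fin r => (l : ℕ) < k), θ l := by
  let d : ℕ → ℝ := fun t => if h : t < r then θ ⟨t, h⟩ else 0
  have hd : ∀ t, d t = 0 ∨ d t = 1 := fun t => by
    by_cases h : t < r
    · simpa [d, h] using hθ ⟨t, h⟩
    · simp [d, h]
  obtain ⟨U, hU⟩ := exists_ternary_orbit r d hd (fun t ht => by simp [d, not_lt.mpr ht])
  refine ⟨bitLayer, ![0, 0, 1, 0, 0, 0], ![U 1, d 0, -1, 0, 0, 0], ![0, 0, 0, 1, 0, 0], 0,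
    fun k _ _ => ?_⟩
  have hinput : (fun j => ![0, 0, 1, 0, 0, 0] j * (k : ℝ) + ![U 1, d 0, -1, 0, 0, 0] j) =
      ![U 1, d 0, (k : ℝ) - 1, 0, 0, 0] := by
    ext j
    fin_cases j <;> simp [sub_eq_add_neg]
  rw [hinput, iterate_bitLayer hd hU]
  simp [Fin.sum_univ_succ, Finset.sum_filter, Finset.sum_range, d]
end
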